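/- Let d be a positive integer and s ∈ (0,1). Then the infimum over nonzero real-valued u ∈ C_c^∞(Ω^{(3)}) of the quotient T_s[u] / ∫_{ℝ^{3d}} V_{s,3}(x)·u(x)² dx is at most the infimum over nonzero w ∈ C_c^∞(ℝ^d∖{0}) of the two-particle Hardy quotient (a_{s,d} ∬_{ℝ^d×ℝ^d} (w(x)−w(y))²/|x−y|^{d+2s} dx dy) / (∫_{ℝ^d} w(x)²/|x|^{2s} dx). In particular, since the latter infimum equals the sharp fractional Hardy constant C_{fH}(d,s), the coefficient C_{fH}(d,s) in the three-particle fractional Hardy inequality is sharp relative to the fixed potential V_{s,3}. -/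

import Mathlib

open MeasureTheory Real

noncomputable section

/-- `ℝ^d` as a Euclidean space. -/
abbrev Euc (d : ℕ) := EuclideanSpace ℝ (Fin d)

/-- The normalisation constant `a_{s,d}` of the fractional Laplacian. -/
def a_sd (d : ℕ) (s : ℝ) : ℝ :=
  s * (2:ℝ) ^ (2*s - 1) * Real.pi ^ (-(d:ℝ)/2) * Real.Gamma (((d:ℝ) + 2*s)/2) /
    Real.Gamma (1 - s)

/-- The three-particle Hardy potential `V_{s,3}` (cyclic sum). -/
def V3 {d : ℕ} (s : ℝ) (x₁ x₂ x₃ : Euc d) : ℝ :=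
    ‖x₃ - x₂‖ ^ (2*s) / (‖x₃ - x₁‖ ^ (2*s) * ‖x₂ - x₁‖ ^ (2*s))
  + ‖x₁ - x₃‖ ^ (2*s) / (‖x₁ - x₂‖ ^ (2*s) * ‖x₃ - x₂‖ ^ (2*s))
  + ‖x₂ - x₁‖ ^ (2*s) / (‖x₂ - x₃‖ ^ (2*s) * ‖x₁ - x₃‖ ^ (2*s))

/-- The fractional kinetic energy `T_s[u]` of an `N`-particle wave function. -/
def kinetic (d N : ℕ) (s : ℝ) (u : (Fin N → Euc d) → ℝ) : ℝ :=
  ∑ i : Fin N, a_sd d s *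
    ∫ x : Fin N → Euc d, ∫ z : Euc d,
      (u x - u (Function.update x i z))^2 / ‖x i - z‖ ^ ((d:ℝ) + 2*s)

section ThreeParticleHardy

open Set Filter Topology
open scoped ENNReal

/-- The squared `L²` norm of `f`, as an extended nonnegative real. -/
def l2Mass {d : ℕ} (f : Euc d → ℝ) : ℝ≥0∞ := ∫⁻ x, ENNReal.ofReal ((f x) ^ 2)

/-- The density of the Gagliardo seminorm of `f`. -/
def gagliardoDensity {d : ℕ} (s : ℝ) (f : Euc d → ℝ) (x y : Euc d) : ℝ≥0∞ :=
  ENNReal.ofReal ((f x - f y) ^ 2 / ‖x - y‖ ^ ((d : ℝ) + 2 * s))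

/-- The squared Gagliardo seminorm of `f`, as an extended nonnegative real. -/
def gagliardo {d : ℕ} (s : ℝ) (f : Euc d → ℝ) : ℝ≥0∞ :=
  ∫⁻ x, ∫⁻ y, gagliardoDensity s f x y

section Tonelli

variable {d : ℕ}

lemma lintegral_pi_fin_three {f : (Fin 3 → Euc d) → ℝ≥0∞} (hf : Measurable f) :
    ∫⁻ x, f x = ∫⁻ a, ∫⁻ b, ∫⁻ c, f ![a, b, c] := by
  have h₁ := (volume_preserving_piFinSuccAbove (fun _ : Fin 3 => Euc d) 0).symm
  rw [← h₁.lintegral_comp hf, Measure.volume_eq_prod,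
    lintegral_prod (fun p => f ((MeasurableEquiv.piFinSuccAbove (fun _ : Fin 3 => Euc d) 0).symm p))
      (hf.comp h₁.measurable).aemeasurable]
  refine lintegral_congr fun a => ?_
  have h₂ := (volume_preserving_finTwoArrow (Euc d)).symm
  have hm : Measurable fun v : Fin 2 → Euc d =>
      f ((MeasurableEquiv.piFinSuccAbove (fun _ : Fin 3 => Euc d) 0).symm (a, v)) := by
    refine hf.comp (h₁.measurable.comp ?_)
    fun_prop
  rw [← h₂.lintegral_comp hm, Measure.volume_eq_prod,
    lintegral_prod (fun p => f ((MeasurableEquiv.piFinSuccAbove (fun _ : Fin 3 => Euc d) 0).symm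
      (a, MeasurableEquiv.finTwoArrow.symm p))) (hm.comp h₂.measurable).aemeasurable]
  refine lintegral_congr fun b => lintegral_congr fun c => ?_
  congr 1
  ext i
  fin_cases i <;> rfl

lemma lintegral_add_four {A : Euc d → Euc d → Euc d → Euc d → ℝ≥0∞}
    (hA : Measurable fun p : ((Euc d × Euc d) × Euc d) × Euc d => A p.1.1.1 p.1.1.2 p.1.2 p.2)
    (B : Euc d → Euc d → Euc d → Euc d → ℝ≥0∞) :
    ∫⁻ a, ∫⁻ b, ∫⁻ c, ∫⁻ z, A a b c z + B a b c z =
      (∫⁻ a, ∫⁻ b, ∫⁻ c, ∫⁻ z, A a b c z) + ∫⁻ a, ∫⁻ b, ∫⁻ c, ∫⁻ z, B a b c z := by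
  have h₁ := hA.lintegral_prod_right' (ν := volume)
  have h₂ := h₁.lintegral_prod_right' (ν := volume)
  have h₃ := h₂.lintegral_prod_right' (ν := volume)
  refine (lintegral_congr fun a => ?_).trans (lintegral_add_left h₃ _)
  refine (lintegral_congr fun b => ?_).trans
    (lintegral_add_left (h₂.comp (measurable_prodMk_left (x := a))) _)
  refine (lintegral_congr fun c => ?_).trans
    (lintegral_add_left (h₁.comp (measurable_prodMk_left (x := (a, b)))) _)
  exact lintegral_add_left (hA.comp (measurable_prodMk_left (x := ((a, b), c)))) _

variable {F : Euc d → Euc d → ℝ≥0∞} {G H K : Euc d → ℝ≥0∞}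

lemma lintegral_shear (hK : Measurable K) (hG : Measurable G) :
    ∫⁻ a, ∫⁻ b, K (a - b) * G b = (∫⁻ x, K x) * ∫⁻ x, G x := by
  rw [lintegral_lintegral_swap (by fun_prop), ← lintegral_const_mul _ hG]
  refine lintegral_congr fun b => ?_
  rw [lintegral_mul_const _ (by fun_prop), lintegral_sub_right_eq_self]

lemma lintegral_shear_three (hK : Measurable K) (hG : Measurable G) (hH : Measurable H) :
    ∫⁻ a, ∫⁻ b, ∫⁻ c, K (a - b) * G b * H c =
      (∫⁻ x, K x) * (∫⁻ x, G x) * ∫⁻ x, H x := by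
  simp_rw [lintegral_const_mul _ hH]
  rw [← lintegral_shear hK hG, ← lintegral_mul_const _ (by fun_prop)]
  refine lintegral_congr fun a => ?_
  rw [lintegral_mul_const _ (by fun_prop)]

lemma lintegral_kernel_first (hF : Measurable (Function.uncurry F)) (hG : Measurable G)
    (hH : Measurable H) :
    ∫⁻ a, ∫⁻ b, ∫⁻ c, ∫⁻ z, F (a - b) (z - b) * G b * H c =
      (∫⁻ x, ∫⁻ y, F x y) * (∫⁻ x, G x) * ∫⁻ x, H x := by
  rw [← lintegral_shear_three hF.lintegral_prod_right hG hH]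
  refine lintegral_congr fun a => lintegral_congr fun b => lintegral_congr fun c => ?_
  have : Measurable (F (a - b)) := hF.of_uncurry_left
  rw [lintegral_mul_const _ (by fun_prop), lintegral_mul_const _ (by fun_prop),
    lintegral_sub_right_eq_self]

lemma lintegral_kernel_reflected (hF : Measurable (Function.uncurry F)) (hG : Measurable G)
    (hH : Measurable H) :
    ∫⁻ a, ∫⁻ b, ∫⁻ c, ∫⁻ z, F (a - b) (a - z) * G b * H c =
      (∫⁻ x, ∫⁻ y, F x y) * (∫⁻ x, G x) * ∫⁻ x, H x := by
  rw [← lintegral_shear_three hF.lintegral_prod_right hG hH]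
  refine lintegral_congr fun a => lintegral_congr fun b => lintegral_congr fun c => ?_
  have : Measurable (F (a - b)) := hF.of_uncurry_left
  rw [lintegral_mul_const _ (by fun_prop), lintegral_mul_const _ (by fun_prop),
    lintegral_sub_left_eq_self]

lemma lintegral_kernel_second (hK : Measurable K) (hF : Measurable (Function.uncurry F))
    (hH : Measurable H) :
    ∫⁻ a, ∫⁻ b, ∫⁻ c, ∫⁻ z, K (a - z) * F b z * H c =
      (∫⁻ x, K x) * (∫⁻ x, ∫⁻ y, F x y) * ∫⁻ x, H x := by
  have hm : Measurable fun q : (Euc d × Euc d) × Euc d => K (q.1.1 - q.2) * F q.1.2 q.2 :=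
    (by fun_prop : Measurable fun q : (Euc d × Euc d) × Euc d => K (q.1.1 - q.2)).mul
      (hF.comp (by fun_prop : Measurable fun q : (Euc d × Euc d) × Euc d => (q.1.2, q.2)))
  have hab : Measurable fun q : Euc d × Euc d => ∫⁻ z, K (q.1 - z) * F q.2 z :=
    hm.lintegral_prod_right'
  have h₁ (a b : Euc d) : ∫⁻ c, ∫⁻ z, K (a - z) * F b z * H c =
      (∫⁻ z, K (a - z) * F b z) * ∫⁻ x, H x := by
    have : Measurable (F b) := hF.of_uncurry_left
    rw [← lintegral_const_mul _ hH]
    refine lintegral_congr fun c => ?_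
    rw [lintegral_mul_const _ (by fun_prop)]
  simp_rw [h₁]
  rw [lintegral_lintegral_swap (μ := volume) (ν := volume)
    (f := fun a b => (∫⁻ z, K (a - z) * F b z) * ∫⁻ x, H x) (hab.mul_const _).aemeasurable]
  have h₂ (b : Euc d) : ∫⁻ a, (∫⁻ z, K (a - z) * F b z) * ∫⁻ x, H x =
      (∫⁻ x, K x) * (∫⁻ z, F b z) * ∫⁻ x, H x := by
    have : Measurable (F b) := hF.of_uncurry_left
    rw [lintegral_mul_const _ (by fun_prop), lintegral_shear hK this]
  simp_rw [h₂]
  have hΦ : Measurable fun x => ∫⁻ y, F x y := hF.lintegral_prod_right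
  rw [lintegral_mul_const _ (hΦ.const_mul _), lintegral_const_mul _ hΦ]

lemma lintegral_kernel_third (hK : Measurable K) (hG : Measurable G)
    (hF : Measurable (Function.uncurry F)) :
    ∫⁻ a, ∫⁻ b, ∫⁻ c, ∫⁻ z, K (a - b) * G b * F c z =
      (∫⁻ x, K x) * (∫⁻ x, G x) * ∫⁻ x, ∫⁻ y, F x y := by
  rw [← lintegral_shear_three hK hG hF.lintegral_prod_right]
  refine lintegral_congr fun a => lintegral_congr fun b => lintegral_congr fun c => ?_
  have : Measurable (F c) := hF.of_uncurry_left
  rw [lintegral_const_mul _ this]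

end Tonelli

section Seminorm

variable {d : ℕ} {s : ℝ} {f : Euc d → ℝ}

lemma measurable_gagliardoDensity (hf : Measurable f) :
    Measurable (Function.uncurry (gagliardoDensity s f)) := by
  unfold gagliardoDensity Function.uncurry
  fun_prop

lemma integrable_truncated_kernel (hd : 0 < d) (hs : s ∈ Ioo (0 : ℝ) 1) :
    Integrable fun x : Euc d => min 1 (‖x‖ ^ 2) / ‖x‖ ^ ((d : ℝ) + 2 * s) := by
  have : Nonempty (Fin d) := ⟨⟨0, hd⟩⟩
  obtain ⟨hs0, hs1⟩ := hs
  rw [integrable_fun_norm_addHaar volume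
    (f := fun r : ℝ => min 1 (r ^ 2) / r ^ ((d : ℝ) + 2 * s)), finrank_euclideanSpace_fin,
    ← Ioc_union_Ioi_eq_Ioi zero_le_one, integrableOn_union]
  have hpow {y : ℝ} (hy : 0 < y) : y ^ (d - 1) = y ^ ((d : ℝ) - 1) := by
    rw [← rpow_natCast, Nat.cast_sub hd, Nat.cast_one]
  constructor
  · have h : IntegrableOn (fun y : ℝ => y ^ (1 - 2 * s)) (Ioc 0 1) :=
      (intervalIntegrable_iff_integrableOn_Ioc_of_le zero_le_one).1
        (intervalIntegral.intervalIntegrable_rpow' (by linarith))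
    refine h.congr_fun (fun y hy => ?_) measurableSet_Ioc
    have hy0 : 0 < y := hy.1
    dsimp only
    rw [min_eq_right (by nlinarith [hy.2]), smul_eq_mul, hpow hy0, ← rpow_two,
      ← rpow_sub hy0, ← rpow_add hy0]
    congr 1
    ring
  · have h : IntegrableOn (fun y : ℝ => y ^ (-1 - 2 * s)) (Ioi 1) :=
      integrableOn_Ioi_rpow_of_lt (by linarith) zero_lt_one
    refine h.congr_fun (fun y hy => ?_) measurableSet_Ioi
    have hy1 : 1 < y := hy
    have hy0 : 0 < y := by linarith
    dsimp only
    rw [min_eq_left (by nlinarith), smul_eq_mul, hpow hy0, one_div, ← rpow_neg hy0.le,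
      ← rpow_add hy0]
    congr 1
    ring

lemma gagliardo_lt_top (hd : 0 < d) (hs : s ∈ Ioo (0 : ℝ) 1)
    (hf : ContDiff ℝ (⊤ : ℕ∞) f) (hc : HasCompactSupport f) : gagliardo s f < ∞ := by
  obtain ⟨L, hL⟩ := ContDiff.lipschitzWith_of_hasCompactSupport hc hf (by simp)
  obtain ⟨M, hM⟩ := hc.exists_bound_of_continuous hf.continuous
  set C : ℝ := max ((2 * M) ^ 2) ((L : ℝ) ^ 2)
  have hC : 0 ≤ C := le_max_of_le_left (sq_nonneg _)
  set k : Euc d → ℝ≥0∞ := fun x => ENNReal.ofReal (min 1 (‖x‖ ^ 2) / ‖x‖ ^ ((d : ℝ) + 2 * s))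
  have hk : Measurable k := by unfold k; fun_prop
  have hkint : ∫⁻ x, k x < ∞ := by
    have h := (integrable_truncated_kernel hd hs).hasFiniteIntegral
    rwa [hasFiniteIntegral_iff_ofReal (.of_forall fun x => by positivity)] at h
  set χ : Euc d → ℝ≥0∞ := (tsupport f).indicator 1
  have hχ : Measurable χ := measurable_one.indicator hc.measurableSet
  have hχint : ∫⁻ x, χ x < ∞ := by
    rw [lintegral_indicator_one hc.measurableSet]
    exact hc.measure_lt_top
  have hnum (x y : Euc d) : (f x - f y) ^ 2 ≤ C * min 1 (‖x - y‖ ^ 2) := by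
    rcases le_total 1 (‖x - y‖ ^ 2) with h | h
    · rw [min_eq_left h, mul_one]
      refine le_max_of_le_left (sq_le_sq' ?_ ?_) <;>
      · have h₁ := abs_le.1 (hM x)
        have h₂ := abs_le.1 (hM y)
        linarith [h₁.1, h₁.2, h₂.1, h₂.2]
    · rw [min_eq_right h]
      have h₁ := hL.dist_le_mul x y
      rw [Real.dist_eq, dist_eq_norm] at h₁
      calc (f x - f y) ^ 2 = |f x - f y| ^ 2 := (sq_abs _).symm
        _ ≤ (L * ‖x - y‖) ^ 2 := by gcongr
        _ = (L : ℝ) ^ 2 * ‖x - y‖ ^ 2 := by ring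
        _ ≤ C * ‖x - y‖ ^ 2 := by gcongr; exact le_max_right _ _
  have hbound (x y : Euc d) : gagliardoDensity s f x y ≤
      ENNReal.ofReal C * (χ x * k (y - x) + k (x - y) * χ y) := by
    have hmain : gagliardoDensity s f x y ≤ ENNReal.ofReal C * k (x - y) := by
      unfold gagliardoDensity k
      rw [← ENNReal.ofReal_mul hC, ← mul_div_assoc]
      gcongr
      exact hnum x y
    have hsymm : k (y - x) = k (x - y) := by simp only [k, norm_sub_rev]
    rw [hsymm]
    by_cases hx : x ∈ tsupport f
    · have : χ x = 1 := by simp [χ, hx]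
      refine hmain.trans (mul_le_mul_right ?_ _)
      rw [this, one_mul]
      exact le_self_add
    · by_cases hy : y ∈ tsupport f
      · have : χ y = 1 := by simp [χ, hy]
        refine hmain.trans (mul_le_mul_right ?_ _)
        rw [this, mul_one]
        exact le_add_self
      · simp [gagliardoDensity, image_eq_zero_of_notMem_tsupport hx,
          image_eq_zero_of_notMem_tsupport hy]
  have hinner (x : Euc d) : ∫⁻ y, ENNReal.ofReal C * (χ x * k (y - x) + k (x - y) * χ y) =
      ENNReal.ofReal C * (χ x * (∫⁻ x, k x) + ∫⁻ y, k (x - y) * χ y) := by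
    rw [lintegral_const_mul _ (by fun_prop), lintegral_add_left (by fun_prop),
      lintegral_const_mul _ (by fun_prop), lintegral_sub_right_eq_self]
  have hlt : ENNReal.ofReal C *
      ((∫⁻ x, χ x) * (∫⁻ x, k x) + (∫⁻ x, k x) * ∫⁻ x, χ x) < ∞ :=
    ENNReal.mul_lt_top ENNReal.ofReal_lt_top (ENNReal.add_lt_top.2
      ⟨ENNReal.mul_lt_top hχint hkint, ENNReal.mul_lt_top hkint hχint⟩)
  refine lt_of_le_of_lt ?_ hlt
  calc gagliardo s f
      ≤ ∫⁻ x, ∫⁻ y, ENNReal.ofReal C * (χ x * k (y - x) + k (x - y) * χ y) :=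
        lintegral_mono fun x => lintegral_mono (hbound x)
    _ = _ := by
        simp_rw [hinner]
        rw [lintegral_const_mul _ (by fun_prop), lintegral_add_left (by fun_prop),
          lintegral_mul_const _ hχ, lintegral_shear hk hχ]

lemma l2Mass_lt_top (hf : Continuous f) (hc : HasCompactSupport f) : l2Mass f < ∞ := by
  have hc2 : HasCompactSupport fun x => f x ^ 2 := hc.comp_left (g := fun t : ℝ => t ^ 2) (by simp)
  have h := ((hf.pow 2).integrable_of_hasCompactSupport (μ := volume) hc2).hasFiniteIntegral
  exact (hasFiniteIntegral_iff_ofReal (.of_forall fun x => sq_nonneg (f x))).1 h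

lemma l2Mass_pos (hf : Continuous f) (hne : f ≠ 0) : 0 < l2Mass f := by
  obtain ⟨x, hx⟩ := Function.ne_iff.1 hne
  rw [l2Mass, lintegral_pos_iff_support (by fun_prop)]
  refine IsOpen.measure_pos volume ?_ ⟨x, ?_⟩
  · exact (ENNReal.continuous_ofReal.comp (hf.pow 2)).isOpen_support
  · have : f x ≠ 0 := hx
    simpa using by positivity

lemma l2Mass_comp_sub (a : Euc d) : l2Mass (fun x => f (x - a)) = l2Mass f :=
  lintegral_sub_right_eq_self (fun x => ENNReal.ofReal (f x ^ 2)) a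

lemma gagliardo_comp_sub (a : Euc d) : gagliardo s (fun x => f (x - a)) = gagliardo s f := by
  have h (x y : Euc d) : gagliardoDensity s (fun x => f (x - a)) x y =
      gagliardoDensity s f (x - a) (y - a) := by
    simp [gagliardoDensity]
  simp_rw [gagliardo, h]
  rw [lintegral_sub_right_eq_self (fun x => ∫⁻ y, gagliardoDensity s f x (y - a)) a]
  exact lintegral_congr fun x => lintegral_sub_right_eq_self (gagliardoDensity s f x) a

lemma lintegral_comp_inv_smul (g : Euc d → ℝ≥0∞) {R : ℝ} (hR : 0 < R) :
    ∫⁻ x, g (R⁻¹ • x) = ENNReal.ofReal (R ^ d) * ∫⁻ x, g x := by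
  have he : MeasurableEmbedding fun x : Euc d => R⁻¹ • x :=
    (Homeomorph.smulOfNeZero R⁻¹ (inv_ne_zero hR.ne')).measurableEmbedding
  rw [← he.lintegral_map, Measure.map_addHaar_smul _ (inv_ne_zero hR.ne'), lintegral_smul_measure,
    finrank_euclideanSpace_fin, inv_pow, inv_inv, abs_of_pos (by positivity), smul_eq_mul]

lemma l2Mass_comp_inv_smul {R : ℝ} (hR : 0 < R) :
    l2Mass (fun x => f (R⁻¹ • x)) = ENNReal.ofReal (R ^ d) * l2Mass f :=
  lintegral_comp_inv_smul (fun x => ENNReal.ofReal (f x ^ 2)) hR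

lemma gagliardo_comp_inv_smul {R : ℝ} (hR : 0 < R) :
    gagliardo s (fun x => f (R⁻¹ • x)) =
      ENNReal.ofReal (R ^ d * R ^ (-(2 * s))) * gagliardo s f := by
  have h (x y : Euc d) : gagliardoDensity s (fun x => f (R⁻¹ • x)) x y =
      ENNReal.ofReal (R ^ (-((d : ℝ) + 2 * s))) * gagliardoDensity s f (R⁻¹ • x) (R⁻¹ • y) := by
    rw [gagliardoDensity, gagliardoDensity, ← ENNReal.ofReal_mul (by positivity), ← smul_sub,
      norm_smul, norm_inv, norm_of_nonneg hR.le, mul_rpow (by positivity) (by positivity),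
      inv_rpow hR.le, rpow_neg hR.le]
    congr 1
    have : R ^ ((d : ℝ) + 2 * s) ≠ 0 := by positivity
    field_simp
  simp_rw [gagliardo, h]
  simp_rw [lintegral_const_mul' _ _ ENNReal.ofReal_ne_top,
    lintegral_comp_inv_smul (gagliardoDensity s f _) hR]
  rw [lintegral_comp_inv_smul (fun x => ENNReal.ofReal (R ^ d) * ∫⁻ y, gagliardoDensity s f x y) hR,
    lintegral_const_mul' _ _ ENNReal.ofReal_ne_top, ← mul_assoc, ← mul_assoc,
    ← ENNReal.ofReal_mul (by positivity), ← ENNReal.ofReal_mul (by positivity)]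
  congr 2
  rw [neg_add, rpow_add hR, rpow_neg hR.le, rpow_natCast]
  field_simp

/-- Bump functions at a large scale have arbitrarily small fractional Rayleigh quotient. -/
lemma exists_bump_small_gagliardo (hd : 0 < d) (hs : s ∈ Ioo (0 : ℝ) 1) {η : ℝ} (hη : 0 < η)
    (ρ : ℝ) :
    ∃ R > ρ, ∃ g : Euc d → ℝ, ContDiff ℝ (⊤ : ℕ∞) g ∧ g 0 = 1 ∧
      (∀ x, g x ≠ 0 → ‖x‖ ≤ R) ∧ gagliardo s g ≤ ENNReal.ofReal η * l2Mass g := by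
  let b : ContDiffBump (0 : Euc d) := ⟨1 / 2, 1, by norm_num, by norm_num⟩
  have hb0 : b 0 = 1 := b.one_of_mem_closedBall (by simp [b])
  have hbne : (b : Euc d → ℝ) ≠ 0 := fun h => by simp [h] at hb0
  have hm0 := l2Mass_pos b.continuous hbne
  have hmt := l2Mass_lt_top b.continuous b.hasCompactSupport
  have hq := gagliardo_lt_top hd hs b.contDiff b.hasCompactSupport
  set q := (gagliardo s b).toReal
  set m := (l2Mass b).toReal
  have hm : 0 < m := ENNReal.toReal_pos hm0.ne' hmt.ne
  have hlim : Tendsto (fun R : ℝ => R ^ (-(2 * s)) * q) atTop (𝓝 0) := by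
    simpa using (tendsto_rpow_neg_atTop (by linarith [hs.1] : 0 < 2 * s)).mul_const q
  obtain ⟨R, hRq, hRρ, hR0⟩ := ((hlim.eventually_le_const (by positivity : 0 < η * m)).and
    ((eventually_gt_atTop ρ).and (eventually_gt_atTop 0))).exists
  refine ⟨R, hRρ, fun x => b (R⁻¹ • x), b.contDiff.comp (by fun_prop), by simpa using hb0, ?_, ?_⟩
  · intro x hx
    have : R⁻¹ • x ∈ Metric.ball (0 : Euc d) 1 := by
      rw [← show b.rOut = 1 from rfl, ← b.support_eq]
      exact hx
    rw [mem_ball_zero_iff, norm_smul, norm_inv, norm_of_nonneg hR0.le, inv_mul_lt_iff₀ hR0] at this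
    linarith
  · rw [gagliardo_comp_inv_smul hR0, l2Mass_comp_inv_smul hR0, ← ENNReal.ofReal_toReal hq.ne,
      ← ENNReal.ofReal_toReal hmt.ne, ← ENNReal.ofReal_mul (by positivity),
      ← ENNReal.ofReal_mul (by positivity), ← ENNReal.ofReal_mul (by positivity)]
    refine ENNReal.ofReal_le_ofReal ?_
    calc R ^ d * R ^ (-(2 * s)) * q = R ^ d * (R ^ (-(2 * s)) * q) := by ring
      _ ≤ R ^ d * (η * m) := by gcongr
      _ = η * (R ^ d * m) := by ring

end Seminorm

section TrialFunction

variable {d : ℕ} {s : ℝ} {w g h : Euc d → ℝ}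

/-- The first two particles are bound by `w`; their position and that of the third particle are
localised by `g` and `h`. -/
def trialFunction (w g h : Euc d → ℝ) (x : Fin 3 → Euc d) : ℝ :=
  w (x 0 - x 1) * g (x 1) * h (x 2)

/-- The kinetic energy of the `i`-th particle, without the factor `a_sd`, as an extended
nonnegative real. -/
def particleEnergy {N : ℕ} (s : ℝ) (u : (Fin N → Euc d) → ℝ) (i : Fin N) : ℝ≥0∞ :=
  ∫⁻ x : Fin N → Euc d, ∫⁻ z : Euc d,
    ENNReal.ofReal ((u x - u (Function.update x i z)) ^ 2 / ‖x i - z‖ ^ ((d : ℝ) + 2 * s))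

lemma ofReal_integral_le_lintegral {α : Type*} [MeasurableSpace α] (μ : Measure α) {f : α → ℝ}
    (hf : 0 ≤ f) : ENNReal.ofReal (∫ x, f x ∂μ) ≤ ∫⁻ x, ENNReal.ofReal (f x) ∂μ := by
  refine (Real.ofReal_le_enorm _).trans ((enorm_integral_le_lintegral_enorm f).trans_eq ?_)
  exact lintegral_congr fun x => Real.enorm_of_nonneg (hf x)

lemma ofReal_integral_le_particleEnergy {N : ℕ} (u : (Fin N → Euc d) → ℝ) (i : Fin N) :
    ENNReal.ofReal (∫ x : Fin N → Euc d, ∫ z : Euc d,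
      (u x - u (Function.update x i z)) ^ 2 / ‖x i - z‖ ^ ((d : ℝ) + 2 * s)) ≤
      particleEnergy s u i := by
  refine (ofReal_integral_le_lintegral _ fun x => integral_nonneg fun z => by positivity).trans ?_
  exact lintegral_mono fun x => ofReal_integral_le_lintegral _ fun z => by positivity

lemma particleEnergy_three {u : (Fin 3 → Euc d) → ℝ} (hu : Continuous u) (i : Fin 3) :
    particleEnergy s u i = ∫⁻ a, ∫⁻ b, ∫⁻ c, ∫⁻ z, ENNReal.ofReal
      ((u ![a, b, c] - u (Function.update ![a, b, c] i z)) ^ 2 /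
        ‖![a, b, c] i - z‖ ^ ((d : ℝ) + 2 * s)) := by
  refine lintegral_pi_fin_three (Measurable.lintegral_prod_right
    (f := fun (x : Fin 3 → Euc d) z => ENNReal.ofReal
      ((u x - u (Function.update x i z)) ^ 2 / ‖x i - z‖ ^ ((d : ℝ) + 2 * s))) ?_)
  have h₁ : Measurable fun p : (Fin 3 → Euc d) × Euc d => u p.1 := by fun_prop
  have h₂ : Measurable fun p : (Fin 3 → Euc d) × Euc d => u (Function.update p.1 i p.2) :=
    (hu.comp (continuous_fst.update i continuous_snd)).measurable
  have h₃ : Measurable fun p : (Fin 3 → Euc d) × Euc d =>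
      ‖p.1 i - p.2‖ ^ ((d : ℝ) + 2 * s) := by fun_prop
  exact (((h₁.sub h₂).pow_const 2).div h₃).ennreal_ofReal

lemma continuous_trialFunction (hw : Continuous w) (hg : Continuous g) (hh : Continuous h) :
    Continuous (trialFunction w g h) := by
  unfold trialFunction
  fun_prop

lemma particleEnergy_trialFunction_zero (hw : Continuous w) (hg : Continuous g)
    (hh : Continuous h) :
    particleEnergy s (trialFunction w g h) 0 = gagliardo s w * l2Mass g * l2Mass h := by
  rw [particleEnergy_three (continuous_trialFunction hw hg hh), gagliardo, l2Mass, l2Mass,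
    ← lintegral_kernel_first (measurable_gagliardoDensity hw.measurable) (by fun_prop)
      (by fun_prop)]
  refine lintegral_congr fun a => lintegral_congr fun b => lintegral_congr fun c =>
    lintegral_congr fun z => ?_
  rw [gagliardoDensity, ← ENNReal.ofReal_mul (by positivity), ← ENNReal.ofReal_mul (by positivity)]
  congr 1
  simp [trialFunction]
  ring

lemma particleEnergy_trialFunction_one_le (hw : Continuous w) (hg : Continuous g)
    (hh : Continuous h) {ε : ℝ} (hε : 0 < ε) :
    particleEnergy s (trialFunction w g h) 1 ≤
      ENNReal.ofReal (1 + ε) * (gagliardo s w * l2Mass g * l2Mass h) +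
        ENNReal.ofReal (1 + 1 / ε) * (l2Mass w * gagliardo s g * l2Mass h) := by
  have hDw := measurable_gagliardoDensity (s := s) hw.measurable
  have hDg := measurable_gagliardoDensity (s := s) hg.measurable
  have hpt (a b c z : Euc d) : ENNReal.ofReal
      ((trialFunction w g h ![a, b, c] - trialFunction w g h (Function.update ![a, b, c] 1 z)) ^ 2 /
        ‖![a, b, c] 1 - z‖ ^ ((d : ℝ) + 2 * s)) ≤
      gagliardoDensity s w (a - b) (a - z) * (ENNReal.ofReal (1 + ε) * ENNReal.ofReal (g b ^ 2)) *
          ENNReal.ofReal (h c ^ 2) +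
        ENNReal.ofReal (w (a - z) ^ 2) * gagliardoDensity s g b z *
          (ENNReal.ofReal (1 + 1 / ε) * ENNReal.ofReal (h c ^ 2)) := by
    have hnorm : ‖(a - b) - (a - z)‖ = ‖b - z‖ := by
      rw [sub_sub_sub_cancel_left, norm_sub_rev]
    rw [gagliardoDensity, gagliardoDensity, hnorm, ← ENNReal.ofReal_mul (by positivity),
      ← ENNReal.ofReal_mul (by positivity), ← ENNReal.ofReal_mul (by positivity),
      ← ENNReal.ofReal_mul (by positivity), ← ENNReal.ofReal_mul (by positivity),
      ← ENNReal.ofReal_mul (by positivity), ← ENNReal.ofReal_add (by positivity) (by positivity)]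
    refine ENNReal.ofReal_le_ofReal ?_
    have hyoung (p q : ℝ) : (p + q) ^ 2 ≤ (1 + ε) * p ^ 2 + (1 + 1 / ε) * q ^ 2 := by
      have : (1 + ε) * p ^ 2 + (1 + 1 / ε) * q ^ 2 - (p + q) ^ 2 = (ε * p - q) ^ 2 / ε := by
        field_simp
        ring
      have : 0 ≤ (ε * p - q) ^ 2 / ε := by positivity
      linarith
    have hy := hyoung ((w (a - b) - w (a - z)) * g b * h c) (w (a - z) * (g b - g z) * h c)
    have hk : 0 ≤ (‖b - z‖ ^ ((d : ℝ) + 2 * s))⁻¹ := by positivity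
    have := mul_le_mul_of_nonneg_right hy hk
    simp only [trialFunction, Function.update_apply, div_eq_mul_inv, Matrix.cons_val,
      Fin.reduceEq, if_true, if_false]
    refine (le_of_eq ?_).trans (this.trans (le_of_eq ?_)) <;> ring
  rw [particleEnergy_three (continuous_trialFunction hw hg hh)]
  refine (lintegral_mono fun a => lintegral_mono fun b => lintegral_mono fun c =>
    lintegral_mono fun z => hpt a b c z).trans_eq ?_
  have hA : Measurable fun p : ((Euc d × Euc d) × Euc d) × Euc d =>
      gagliardoDensity s w (p.1.1.1 - p.1.1.2) (p.1.1.1 - p.2) *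
        (ENNReal.ofReal (1 + ε) * ENNReal.ofReal (g p.1.1.2 ^ 2)) *
          ENNReal.ofReal (h p.1.2 ^ 2) := by
    refine (Measurable.mul (hDw.comp (?_ : Measurable fun p : ((Euc d × Euc d) × Euc d) × Euc d =>
      (p.1.1.1 - p.1.1.2, p.1.1.1 - p.2))) ?_).mul ?_ <;> fun_prop
  rw [lintegral_add_four hA,
    lintegral_kernel_reflected hDw (G := fun b => ENNReal.ofReal (1 + ε) * ENNReal.ofReal (g b ^ 2))
      (by fun_prop) (by fun_prop),
    lintegral_kernel_second (K := fun x => ENNReal.ofReal (w x ^ 2))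
      (H := fun c => ENNReal.ofReal (1 + 1 / ε) * ENNReal.ofReal (h c ^ 2))
      (by fun_prop) hDg (by fun_prop),
    lintegral_const_mul _ (by fun_prop), lintegral_const_mul _ (by fun_prop)]
  unfold gagliardo l2Mass
  ring

lemma particleEnergy_trialFunction_two (hw : Continuous w) (hg : Continuous g)
    (hh : Continuous h) :
    particleEnergy s (trialFunction w g h) 2 = l2Mass w * l2Mass g * gagliardo s h := by
  rw [particleEnergy_three (continuous_trialFunction hw hg hh), gagliardo, l2Mass, l2Mass,
    ← lintegral_kernel_third (by fun_prop) (by fun_prop)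
      (measurable_gagliardoDensity hh.measurable)]
  refine lintegral_congr fun a => lintegral_congr fun b => lintegral_congr fun c =>
    lintegral_congr fun z => ?_
  rw [gagliardoDensity, ← ENNReal.ofReal_mul (by positivity), ← ENNReal.ofReal_mul (by positivity)]
  congr 1
  simp [trialFunction]
  ring

lemma V3_nonneg (s : ℝ) (a b c : Euc d) : 0 ≤ V3 s a b c := by
  unfold V3
  positivity

lemma two_div_le_V3 (s : ℝ) {a b c : Euc d} (hab : a ≠ b) (hac : a ≠ c) (hbc : b ≠ c) :
    2 / ‖a - b‖ ^ (2 * s) ≤ V3 s a b c := by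
  unfold V3
  rw [norm_sub_rev b a, norm_sub_rev c a, norm_sub_rev c b]
  have hA : 0 < ‖a - b‖ ^ (2 * s) := rpow_pos_of_pos (norm_sub_pos_iff.2 hab) _
  have hB : 0 < ‖a - c‖ ^ (2 * s) := rpow_pos_of_pos (norm_sub_pos_iff.2 hac) _
  have hC : 0 < ‖b - c‖ ^ (2 * s) := rpow_pos_of_pos (norm_sub_pos_iff.2 hbc) _
  set A := ‖a - b‖ ^ (2 * s)
  set B := ‖a - c‖ ^ (2 * s)
  set C := ‖b - c‖ ^ (2 * s)
  have h : C / (B * A) + B / (A * C) + A / (C * B) - 2 / A =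
      ((B - C) ^ 2 + A ^ 2) / (A * B * C) := by
    field_simp
    ring
  have : 0 ≤ ((B - C) ^ 2 + A ^ 2) / (A * B * C) := by positivity
  linarith

lemma le_ofReal_integral_V3 (hw : Continuous w) (hg : Continuous g) (hh : Continuous h)
    (hsupp : ∀ x, trialFunction w g h x ≠ 0 → ∀ i j, i ≠ j → x i ≠ x j)
    (hint : Integrable fun x : Fin 3 → Euc d =>
      V3 s (x 0) (x 1) (x 2) * trialFunction w g h x ^ 2) :
    ENNReal.ofReal 2 * (∫⁻ x, ENNReal.ofReal (w x ^ 2 / ‖x‖ ^ (2 * s))) * l2Mass g * l2Mass h ≤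
      ENNReal.ofReal (∫ x : Fin 3 → Euc d,
        V3 s (x 0) (x 1) (x 2) * trialFunction w g h x ^ 2) := by
  rw [ofReal_integral_eq_lintegral_ofReal hint
    (.of_forall fun x => mul_nonneg (V3_nonneg _ _ _ _) (sq_nonneg _))]
  have hpt (x : Fin 3 → Euc d) :
      ENNReal.ofReal 2 * ENNReal.ofReal (w (x 0 - x 1) ^ 2 / ‖x 0 - x 1‖ ^ (2 * s)) *
          ENNReal.ofReal (g (x 1) ^ 2) * ENNReal.ofReal (h (x 2) ^ 2) ≤
        ENNReal.ofReal (V3 s (x 0) (x 1) (x 2) * trialFunction w g h x ^ 2) := by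
    rw [← ENNReal.ofReal_mul (by positivity),
      ← ENNReal.ofReal_mul (by positivity), ← ENNReal.ofReal_mul (by positivity)]
    refine ENNReal.ofReal_le_ofReal ?_
    have heq : 2 * (w (x 0 - x 1) ^ 2 / ‖x 0 - x 1‖ ^ (2 * s)) * g (x 1) ^ 2 * h (x 2) ^ 2 =
        2 / ‖x 0 - x 1‖ ^ (2 * s) * trialFunction w g h x ^ 2 := by
      unfold trialFunction
      ring
    rw [heq]
    by_cases hx : trialFunction w g h x = 0
    · simp [hx]
    · have hne := hsupp x hx
      gcongr
      exact two_div_le_V3 s (hne 0 1 (by decide)) (hne 0 2 (by decide)) (hne 1 2 (by decide))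
  refine le_trans (le_of_eq ?_) (lintegral_mono hpt)
  have hK : Measurable fun x => ENNReal.ofReal (w x ^ 2 / ‖x‖ ^ (2 * s)) := by fun_prop
  rw [lintegral_pi_fin_three (by fun_prop), l2Mass, l2Mass, ← lintegral_const_mul _ hK]
  exact (lintegral_shear_three
    (K := fun x => ENNReal.ofReal 2 * ENNReal.ofReal (w x ^ 2 / ‖x‖ ^ (2 * s)))
    (by fun_prop) (by fun_prop) (by fun_prop)).symm

end TrialFunction

section Sharpness

variable {d : ℕ} {s : ℝ} {w : Euc d → ℝ}

lemma a_sd_nonneg (d : ℕ) (hs : s ∈ Ioo (0 : ℝ) 1) : 0 ≤ a_sd d s := by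
  have h₁ : 0 ≤ Real.Gamma (((d : ℝ) + 2 * s) / 2) :=
    Real.Gamma_nonneg_of_nonneg (by have := hs.1; positivity)
  have h₂ : 0 ≤ Real.Gamma (1 - s) := Real.Gamma_nonneg_of_nonneg (by linarith [hs.2])
  have := hs.1
  unfold a_sd
  positivity

lemma kinetic_nonneg (hs : s ∈ Ioo (0 : ℝ) 1) {N : ℕ} (u : (Fin N → Euc d) → ℝ) :
    0 ≤ kinetic d N s u :=
  Finset.sum_nonneg fun i _ => mul_nonneg (a_sd_nonneg d hs)
    (integral_nonneg fun x => integral_nonneg fun z => by positivity)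

lemma integral_integral_eq_toReal_gagliardo (hw : Measurable w) (hfin : gagliardo s w < ∞) :
    ∫ x, ∫ y, (w x - w y) ^ 2 / ‖x - y‖ ^ ((d : ℝ) + 2 * s) = (gagliardo s w).toReal := by
  have hD := measurable_gagliardoDensity (s := s) hw
  have hm : Measurable fun x => ∫⁻ y, gagliardoDensity s w x y := hD.lintegral_prod_right'
  rw [gagliardo, ← integral_toReal hm.aemeasurable (ae_lt_top hm hfin.ne)]
  refine integral_congr_ae (.of_forall fun x => ?_)
  refine integral_eq_lintegral_of_nonneg_ae (.of_forall fun y => by positivity) ?_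
  exact Measurable.aestronglyMeasurable (by fun_prop)

lemma continuous_sq_div_norm_rpow (hw : Continuous w) (h0 : tsupport w ⊆ {x | x ≠ 0}) :
    Continuous fun x => w x ^ 2 / ‖x‖ ^ (2 * s) := by
  rw [continuous_iff_continuousAt]
  intro x
  by_cases hx : x ∈ tsupport w
  · have hx0 : ‖x‖ ≠ 0 := norm_ne_zero_iff.2 (h0 hx)
    exact (hw.continuousAt.pow 2).div (continuousAt_id.norm.rpow_const (.inl hx0))
      (by positivity)
  · have h := notMem_tsupport_iff_eventuallyEq.1 hx
    refine (continuousAt_const (y := (0 : ℝ))).congr ?_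
    filter_upwards [h] with y hy
    simp [hy]

lemma hasCompactSupport_sq_div_norm_rpow (hc : HasCompactSupport w) :
    HasCompactSupport fun x => w x ^ 2 / ‖x‖ ^ (2 * s) :=
  hc.mono fun x hx hwx => hx (by simp [hwx])

/-- Admissible three-particle functions whose energy nearly decouples into twice the energy of the
bound pair described by `w`. -/
lemma exists_trialFunction (hd : 0 < d) (hs : s ∈ Ioo (0 : ℝ) 1)
    (hw : ContDiff ℝ (⊤ : ℕ∞) w) (hc : HasCompactSupport w) (h0 : tsupport w ⊆ {x | x ≠ 0})
    (hne : w ≠ 0) {ε : ℝ} (hε : 0 < ε) :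
    ∃ u : (Fin 3 → Euc d) → ℝ, ContDiff ℝ (⊤ : ℕ∞) u ∧ HasCompactSupport u ∧
      tsupport u ⊆ {x | ∀ i j, i ≠ j → x i ≠ x j} ∧ u ≠ 0 ∧
      ∃ m > 0, kinetic d 3 s u ≤ a_sd d s * ((2 + ε) * (gagliardo s w).toReal + ε) * m ∧
        (Integrable (fun x : Fin 3 → Euc d => V3 s (x 0) (x 1) (x 2) * u x ^ 2) →
          2 * (∫ x, w x ^ 2 / ‖x‖ ^ (2 * s)) * m ≤
            ∫ x : Fin 3 → Euc d, V3 s (x 0) (x 1) (x 2) * u x ^ 2) := by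
  have hqt := gagliardo_lt_top hd hs hw hc
  have hnt := l2Mass_lt_top hw.continuous hc
  have hn0 := l2Mass_pos hw.continuous hne
  set q := (gagliardo s w).toReal
  set n := (l2Mass w).toReal
  have hnpos : 0 < n := ENNReal.toReal_pos hn0.ne' hnt.ne
  obtain ⟨ρ, hρ⟩ := hc.isBounded.exists_norm_le
  set η : ℝ := ε / ((2 + 1 / ε) * n) with hη
  obtain ⟨R, hRρ, g, hg, hg0, hgR, hgη⟩ :=
    exists_bump_small_gagliardo hd hs (show 0 < η by positivity) (max ρ 0)
  have hR0 : 0 < R := (le_max_right _ _).trans_lt hRρ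
  have hρR : ρ < R := (le_max_left _ _).trans_lt hRρ
  have : Nonempty (Fin d) := ⟨⟨0, hd⟩⟩
  obtain ⟨e, he⟩ := exists_norm_eq (Euc d) (show 0 ≤ 4 * R by positivity)
  set h : Euc d → ℝ := fun x => g (x - e) with hh
  have hhc : ContDiff ℝ (⊤ : ℕ∞) h := hg.comp (by fun_prop)
  set u := trialFunction w g h with hu
  set S : Set (Fin 3 → Euc d) :=
    {x | x 0 - x 1 ∈ tsupport w ∧ ‖x 1‖ ≤ R ∧ ‖x 2 - e‖ ≤ R}
  have hSclosed : IsClosed S :=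
    ((isClosed_tsupport w).preimage
      (by fun_prop : Continuous fun x : Fin 3 → Euc d => x 0 - x 1)).inter
      ((isClosed_le (continuous_apply 1).norm continuous_const).inter
        (isClosed_le ((continuous_apply 2).sub continuous_const).norm continuous_const))
  have hsuppS : Function.support u ⊆ S := by
    intro x hx
    have hx' : w (x 0 - x 1) * g (x 1) * h (x 2) ≠ 0 := hx
    simp only [mul_ne_zero_iff] at hx'
    exact ⟨subset_tsupport w hx'.1.1, hgR _ hx'.1.2, hgR _ hx'.2⟩
  have htS : tsupport u ⊆ S := closure_minimal hsuppS hSclosed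
  have hSd : S ⊆ {x | ∀ i j, i ≠ j → x i ≠ x j} := by
    rintro x ⟨h₁, h₂, h₃⟩
    have h01 : x 0 ≠ x 1 := sub_ne_zero.1 (h0 h₁)
    have hsep : 2 * R ≤ ‖x 1 - x 2‖ := by
      have := norm_add₃_le (a := x 1) (b := x 2 - x 1) (c := e - x 2)
      rw [show x 1 + (x 2 - x 1) + (e - x 2) = e by abel, he, norm_sub_rev (x 2), norm_sub_rev e]
        at this
      linarith
    have h12 : x 1 ≠ x 2 := fun h => by
      rw [h, sub_self, norm_zero] at hsep
      linarith
    have h02 : x 0 ≠ x 2 := fun h => by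
      have := hρ _ h₁
      rw [h, norm_sub_rev] at this
      linarith
    intro i j hij
    fin_cases i <;> fin_cases j <;>
      first
      | exact absurd rfl hij
      | exact h01
      | exact h02
      | exact h12
      | exact h01.symm
      | exact h02.symm
      | exact h12.symm
  have hSb : S ⊆ Metric.closedBall 0 (5 * R) := by
    rintro x ⟨h₁, h₂, h₃⟩
    rw [mem_closedBall_zero_iff, pi_norm_le_iff_of_nonneg (by positivity)]
    have h0' : ‖x 0‖ ≤ 5 * R := by
      have := norm_add_le (x 0 - x 1) (x 1)
      rw [sub_add_cancel] at this
      linarith [hρ _ h₁]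
    have h2' : ‖x 2‖ ≤ 5 * R := by
      have := norm_add_le (x 2 - e) e
      rw [sub_add_cancel] at this
      linarith
    intro i
    fin_cases i
    · exact h0'
    · exact h₂.trans (by linarith)
    · exact h2'
  have hgc : HasCompactSupport g := HasCompactSupport.of_support_subset_isCompact
    (isCompact_closedBall 0 R) fun x hx => mem_closedBall_zero_iff.2 (hgR x hx)
  have hgne : g ≠ 0 := fun h => by simp [h] at hg0
  have hmt := l2Mass_lt_top hg.continuous hgc
  have hm0 := l2Mass_pos hg.continuous hgne
  set m := (l2Mass g).toReal
  have hmpos : 0 < m := ENNReal.toReal_pos hm0.ne' hmt.ne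
  have hQ : gagliardo s w = ENNReal.ofReal q := (ENNReal.ofReal_toReal hqt.ne).symm
  have hN : l2Mass w = ENNReal.ofReal n := (ENNReal.ofReal_toReal hnt.ne).symm
  have hM : l2Mass g = ENNReal.ofReal m := (ENNReal.ofReal_toReal hmt.ne).symm
  have hMh : l2Mass h = ENNReal.ofReal m := (l2Mass_comp_sub e).trans hM
  have hq0 : 0 ≤ q := ENNReal.toReal_nonneg
  have hηpos : 0 < η := by positivity
  have hGg : gagliardo s g ≤ ENNReal.ofReal (η * m) := by
    rwa [ENNReal.ofReal_mul hηpos.le, ← hM]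
  have hGh : gagliardo s h ≤ ENNReal.ofReal (η * m) := (gagliardo_comp_sub e).trans_le hGg
  refine ⟨u, ?_, ?_, htS.trans hSd, ?_, m * m, by positivity, ?_, ?_⟩
  · rw [hu]
    unfold trialFunction
    fun_prop
  · exact HasCompactSupport.of_support_subset_isCompact (isCompact_closedBall 0 (5 * R))
      (hsuppS.trans hSb)
  · obtain ⟨y, hy⟩ := Function.ne_iff.1 hne
    refine Function.ne_iff.2 ⟨![y, 0, e], ?_⟩
    simpa [hu, trialFunction, hh, hg0] using hy
  · have hreal {r : ℝ} (hr : 0 ≤ r) (i : Fin 3) (hi : particleEnergy s u i ≤ ENNReal.ofReal r) :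
        ∫ x : Fin 3 → Euc d, ∫ z : Euc d,
          (u x - u (Function.update x i z)) ^ 2 / ‖x i - z‖ ^ ((d : ℝ) + 2 * s) ≤ r :=
      (ENNReal.ofReal_le_ofReal_iff hr).1 ((ofReal_integral_le_particleEnergy u i).trans hi)
    have e₀ := hreal (r := q * m * m) (by positivity) 0 (by
      rw [particleEnergy_trialFunction_zero hw.continuous hg.continuous hhc.continuous, hQ, hM, hMh,
        ← ENNReal.ofReal_mul (by positivity), ← ENNReal.ofReal_mul (by positivity)])
    have e₁ := hreal (r := (1 + ε) * (q * m * m) + (1 + 1 / ε) * (n * (η * m) * m))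
      (by positivity) 1 (by
        refine (particleEnergy_trialFunction_one_le hw.continuous hg.continuous hhc.continuous
          hε).trans ?_
        rw [hQ, hM, hMh, hN,
          ENNReal.ofReal_add (p := (1 + ε) * (q * m * m)) (by positivity) (by positivity),
          ENNReal.ofReal_mul (by positivity), ENNReal.ofReal_mul (by positivity),
          ENNReal.ofReal_mul (by positivity), ENNReal.ofReal_mul (by positivity),
          ENNReal.ofReal_mul (p := n * (η * m)) (by positivity),
          ENNReal.ofReal_mul (p := n) (by positivity)]
        gcongr)
    have e₂ := hreal (r := n * m * (η * m)) (by positivity) 2 (by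
      rw [particleEnergy_trialFunction_two hw.continuous hg.continuous hhc.continuous, hN, hM,
        ENNReal.ofReal_mul (by positivity), ENNReal.ofReal_mul (by positivity)]
      gcongr)
    have hεη : (2 + 1 / ε) * n * η = ε := by
      rw [hη]
      field_simp
    rw [kinetic, ← Finset.mul_sum, Fin.sum_univ_three, mul_assoc]
    refine mul_le_mul_of_nonneg_left ((add_le_add (add_le_add e₀ e₁) e₂).trans_eq ?_)
      (a_sd_nonneg d hs)
    linear_combination m * m * hεη
  · intro hint
    have hwint : Integrable fun x => w x ^ 2 / ‖x‖ ^ (2 * s) :=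
      (continuous_sq_div_norm_rpow hw.continuous h0).integrable_of_hasCompactSupport
        (hasCompactSupport_sq_div_norm_rpow hc)
    have hsupp : ∀ x, trialFunction w g h x ≠ 0 → ∀ i j, i ≠ j → x i ≠ x j :=
      fun x hx => hSd (hsuppS hx)
    have hle := le_ofReal_integral_V3 hw.continuous hg.continuous hhc.continuous hsupp hint
    rw [← ofReal_integral_eq_lintegral_ofReal hwint (.of_forall fun x => by positivity), hM, hMh]
      at hle
    have hP : 0 ≤ ∫ x, w x ^ 2 / ‖x‖ ^ (2 * s) := integral_nonneg fun x => by positivity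
    have hV : 0 ≤ ∫ x : Fin 3 → Euc d, V3 s (x 0) (x 1) (x 2) * u x ^ 2 :=
      integral_nonneg fun x => mul_nonneg (V3_nonneg _ _ _ _) (sq_nonneg _)
    rw [← ENNReal.ofReal_le_ofReal_iff hV]
    refine le_trans (le_of_eq ?_) hle
    rw [← mul_assoc, ENNReal.ofReal_mul (mul_nonneg (mul_nonneg two_pos.le hP) hmpos.le),
      ENNReal.ofReal_mul (mul_nonneg two_pos.le hP), ENNReal.ofReal_mul two_pos.le]

lemma exists_contDiff_tsupport_subset_ne_zero (hd : 0 < d) :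
    ∃ w : Euc d → ℝ, ContDiff ℝ (⊤ : ℕ∞) w ∧ HasCompactSupport w ∧
      tsupport w ⊆ {x | x ≠ 0} ∧ w ≠ 0 := by
  have : Nonempty (Fin d) := ⟨⟨0, hd⟩⟩
  obtain ⟨e, he⟩ := exists_norm_eq (Euc d) (show (0 : ℝ) ≤ 2 by norm_num)
  let b : ContDiffBump e := ⟨1 / 2, 1, by norm_num, by norm_num⟩
  refine ⟨b, b.contDiff, b.hasCompactSupport, ?_, fun h => ?_⟩
  · rw [b.tsupport_eq]
    rintro x hx rfl
    rw [mem_closedBall_iff_norm, zero_sub, norm_neg, he] at hx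
    norm_num [b] at hx
  · have hb : b e = 1 := b.one_of_mem_closedBall (by simp [b])
    simp [h] at hb

end Sharpness

end ThreeParticleHardy

/-- Sharpness of the coefficient in the three-particle fractional Hardy inequality,
relative to the fixed potential `V_{s,3}`: the three-particle infimum is at most the
two-particle fractional Hardy quotient infimum (which equals `C_{fH}(d,s)`). -/
theorem three_particle_constant_sharp
    (d : ℕ) (hd : 0 < d) (s : ℝ) (hs : s ∈ Set.Ioo (0:ℝ) 1) :
    sInf {r : ℝ | ∃ u : (Fin 3 → Euc d) → ℝ,
        ContDiff ℝ (⊤ : ℕ∞) u ∧ HasCompactSupport u ∧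
        tsupport u ⊆ {x : Fin 3 → Euc d | ∀ i j, i ≠ j → x i ≠ x j} ∧ u ≠ 0 ∧
        r = kinetic d 3 s u /
          ∫ x : Fin 3 → Euc d, V3 s (x 0) (x 1) (x 2) * (u x)^2}
    ≤ sInf {r : ℝ | ∃ w : Euc d → ℝ,
        ContDiff ℝ (⊤ : ℕ∞) w ∧ HasCompactSupport w ∧
        tsupport w ⊆ {x : Euc d | x ≠ 0} ∧ w ≠ 0 ∧
        r = (a_sd d s *
              ∫ x : Euc d, ∫ y : Euc d, (w x - w y)^2 / ‖x - y‖ ^ ((d:ℝ) + 2*s)) /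
          ∫ x : Euc d, (w x)^2 / ‖x‖ ^ (2*s)} := by
  have ha := a_sd_nonneg d hs
  obtain ⟨w₀, hw₀⟩ := exists_contDiff_tsupport_subset_ne_zero hd
  refine le_csInf ⟨_, w₀, hw₀.1, hw₀.2.1, hw₀.2.2.1, hw₀.2.2.2, rfl⟩ ?_
  rintro r ⟨w, hw, hc, h0, hne, rfl⟩
  rw [integral_integral_eq_toReal_gagliardo hw.continuous.measurable (gagliardo_lt_top hd hs hw hc)]
  set q := (gagliardo s w).toReal
  have hq0 : 0 ≤ q := ENNReal.toReal_nonneg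
  set p := ∫ x, w x ^ 2 / ‖x‖ ^ (2 * s)
  have hp : 0 < p := by
    obtain ⟨y, hy⟩ := Function.ne_iff.1 hne
    have hy' : w y ≠ 0 := hy
    have hy0 : ‖y‖ ≠ 0 := norm_ne_zero_iff.2 (h0 (subset_tsupport w hy'))
    exact (continuous_sq_div_norm_rpow hw.continuous h0
      ).integral_pos_of_hasCompactSupport_nonneg_nonzero
      (hasCompactSupport_sq_div_norm_rpow hc) (fun x => by positivity) (x := y) (by positivity)
  have hlim : Filter.Tendsto (fun ε : ℝ => a_sd d s * ((2 + ε) * q + ε) / (2 * p))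
      (nhdsWithin 0 (Set.Ioi 0)) (nhds (a_sd d s * q / p)) := by
    have h : ContinuousAt (fun ε : ℝ => a_sd d s * ((2 + ε) * q + ε) / (2 * p)) 0 := by fun_prop
    have h' := h.tendsto.mono_left (nhdsWithin_le_nhds (s := Set.Ioi 0))
    convert h' using 2
    field_simp
    ring
  refine ge_of_tendsto hlim ?_
  filter_upwards [self_mem_nhdsWithin] with ε hε
  have hε0 : 0 < ε := hε
  obtain ⟨u, hu, huc, hus, hune, m, hm, hk, hV⟩ := exists_trialFunction hd hs hw hc h0 hne hε0
  refine le_trans (csInf_le ⟨0, ?_⟩ ⟨u, hu, huc, hus, hune, rfl⟩) ?_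
  · rintro r ⟨v, -, -, -, -, rfl⟩
    exact div_nonneg (kinetic_nonneg hs v)
      (integral_nonneg fun x => mul_nonneg (V3_nonneg _ _ _ _) (sq_nonneg _))
  · by_cases hint : Integrable fun x : Fin 3 → Euc d => V3 s (x 0) (x 1) (x 2) * u x ^ 2
    · calc _ ≤ a_sd d s * ((2 + ε) * q + ε) * m / (2 * p * m) := by
            gcongr
            exact hV hint
        _ = _ := mul_div_mul_right _ _ hm.ne'
    · rw [integral_undef hint, div_zero]
      positivity
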